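/- arXiv:1112.2864 — 2 statements merged into one kernel-verified Lean document; each statement's English description precedes it below -/
import Mathlib

section
/- Let G = (V, Σ, P) be a context-free grammar with n = |V| variables and X ∈ V. Then for every k ≥ 0 and every v ∈ ℕ^Σ, the number of (G,X)-derivation trees t with π(Y(t)) = v and dim(t) ≤ n + k is at least min(camb_{G,X}(v), 2^{2^k}). -/
/-- A context-free grammar over variables `V` and terminal alphabet `A`:
a set of productions `X → rhs` with `rhs ∈ (A ⊕ V)*`. -/
structure CFG (V : Type) (A : Type) where
  P : Set (V × List (A ⊕ V))

/-- The list of variable occurrences (in order) in a sentential form. -/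
def varsOf {V A : Type} (rhs : List (A ⊕ V)) : List V :=
  rhs.filterMap Sum.getRight?

/-- Raw derivation trees: each node is labeled by a variable and a right-hand side,
and carries the list of subtrees (one per variable occurrence of the rhs). -/
inductive RawTree (V A : Type) : Type where
  | node (X : V) (rhs : List (A ⊕ V)) (children : List (RawTree V A)) : RawTree V A

namespace RawTree

/-- `IsDTree G X t` : `t` is a `(G,X)`-derivation tree. -/
inductive IsDTree {V A : Type} (G : CFG V A) : V → RawTree V A → Prop where
  | node {X : V} {rhs : List (A ⊕ V)} {children : List (RawTree V A)}
      (hP : (X, rhs) ∈ G.P)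
      (hch : List.Forall₂ (IsDTree G) (varsOf rhs) children) :
      IsDTree G X (RawTree.node X rhs children)

/-- Helper for `yield`: interleave the terminals of a rhs with the yields of the
subtrees (consumed in order, one per variable occurrence). -/
def yieldAux {V A : Type} : List (A ⊕ V) → List (List A) → List A
  | [], _ => []
  | (Sum.inl a) :: rest, ys => a :: yieldAux rest ys
  | (Sum.inr _) :: rest, [] => yieldAux rest []
  | (Sum.inr _) :: rest, y :: ys => y ++ yieldAux rest ys

/-- The yield of a derivation tree. -/
def yield {V A : Type} : RawTree V A → List A
  | .node _ rhs cs => yieldAux rhs (cs.attach.map (fun c => yield c.1))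
decreasing_by have := List.sizeOf_lt_of_mem c.2; simp; omega

/-- The dimension (Horton–Strahler number) of a tree. -/
def dim {V A : Type} : RawTree V A → ℕ
  | .node _ _ cs =>
    let ds := cs.attach.map (fun c => dim c.1)
    if ds.isEmpty then 0
    else
      let d := ds.foldr max 0
      if ds.count d = 1 then d else d + 1
decreasing_by have := List.sizeOf_lt_of_mem c.2; simp; omega

/-- The set of variables occurring as left-hand side of a label of some node of `t`. -/
def lhsVars {V A : Type} [DecidableEq V] : RawTree V A → Finset V
  | .node X _ cs => insert X ((cs.attach.map (fun c => lhsVars c.1)).foldr (· ∪ ·) ∅)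
decreasing_by have := List.sizeOf_lt_of_mem c.2; simp; omega

/-- `l(t)`: the number of distinct variables labelling (as lhs) the nodes of `t`. -/
def numLhsVars {V A : Type} [DecidableEq V] (t : RawTree V A) : ℕ := (lhsVars t).card

end RawTree

open RawTree

/-- The Parikh image of a word. -/
noncomputable def parikh {A : Type} (w : List A) : A →₀ ℕ :=
  (w.map (fun a => Finsupp.single a 1)).sum

/-- The ambiguity of `(G,X)` at a word `w`: the number of `(G,X)`-derivation trees
with yield `w`, as an extended natural number. -/
noncomputable def amb {V A : Type} (G : CFG V A) (X : V) (w : List A) : ℕ∞ :=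
  Set.encard {t : RawTree V A | IsDTree G X t ∧ yield t = w}

/-- The commutative ambiguity of `(G,X)` at a Parikh vector `v`: the number of
`(G,X)`-derivation trees whose yield has Parikh image `v`. -/
noncomputable def camb {V A : Type} (G : CFG V A) (X : V) (v : A →₀ ℕ) : ℕ∞ :=
  Set.encard {t : RawTree V A | IsDTree G X t ∧ parikh (yield t) = v}

/-- One rewriting step of `G` on sentential forms. -/
def Produces {V A : Type} (G : CFG V A) (α β : List (A ⊕ V)) : Prop :=
  ∃ pre post X rhs, (X, rhs) ∈ G.P ∧
    α = pre ++ Sum.inr X :: post ∧ β = pre ++ rhs ++ post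

/-- Derivation in one or more steps (`⇒⁺`). -/
def DerivesPlus {V A : Type} (G : CFG V A) : List (A ⊕ V) → List (A ⊕ V) → Prop :=
  Relation.TransGen (Produces G)

/-- Derivation in zero or more steps (`⇒*`). -/
def Derives {V A : Type} (G : CFG V A) : List (A ⊕ V) → List (A ⊕ V) → Prop :=
  Relation.ReflTransGen (Produces G)

/-- A grammar is nonexpansive if no variable `X` derives a sentential form
containing two or more occurrences of `X`. -/
def Nonexpansive {V A : Type} [DecidableEq V] [DecidableEq A] (G : CFG V A) : Prop :=
  ∀ (X : V) (α : List (A ⊕ V)), DerivesPlus G [Sum.inr X] α → α.count (Sum.inr X) ≤ 1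

namespace List

theorem forall₂_append_right_iff {α β : Type*} {R : α → β → Prop} {l : List α} {l₁ l₂ : List β} :
    Forall₂ R l (l₁ ++ l₂) ↔ ∃ k₁ k₂, l = k₁ ++ k₂ ∧ Forall₂ R k₁ l₁ ∧ Forall₂ R k₂ l₂ := by
  constructor
  · intro h
    exact ⟨l.take l₁.length, l.drop l₁.length, (take_append_drop _ _).symm,
      forall₂_take_append l l₁ l₂ h, forall₂_drop_append l l₁ l₂ h⟩
  · rintro ⟨k₁, k₂, rfl, h₁, h₂⟩
    exact rel_append h₁ h₂

theorem forall₂_append_cons_iff {α β : Type*} {R : α → β → Prop} {l : List α} {l₁ l₂ : List β}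
    {b : β} :
    Forall₂ R l (l₁ ++ b :: l₂) ↔
      ∃ k₁ a k₂, l = k₁ ++ a :: k₂ ∧ Forall₂ R k₁ l₁ ∧ R a b ∧ Forall₂ R k₂ l₂ := by
  rw [forall₂_append_right_iff]
  constructor
  · rintro ⟨k₁, k₂, rfl, h₁, h₂⟩
    obtain ⟨a, k₃, hab, h₃, rfl⟩ := forall₂_cons_right_iff.1 h₂
    exact ⟨k₁, a, k₃, rfl, h₁, hab, h₃⟩
  · rintro ⟨k₁, a, k₂, rfl, h₁, hab, h₂⟩
    exact ⟨k₁, a :: k₂, rfl, h₁, .cons hab h₂⟩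

theorem Forall₂.exists_left_of_mem {α β : Type*} {R : α → β → Prop} {l : List α} {m : List β}
    (h : Forall₂ R l m) {b : β} (hb : b ∈ m) : ∃ a ∈ l, R a b := by
  induction h with
  | nil => simp at hb
  | cons hab _ ih =>
    rcases mem_cons.1 hb with rfl | hb
    · exact ⟨_, mem_cons_self, hab⟩
    · obtain ⟨a, ha, h⟩ := ih hb
      exact ⟨a, mem_cons_of_mem _ ha, h⟩

theorem Forall₂.exists_right_of_mem {α β : Type*} {R : α → β → Prop} {l : List α} {m : List β}
    (h : Forall₂ R l m) {a : α} (ha : a ∈ l) : ∃ b ∈ m, R a b :=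
  h.flip.exists_left_of_mem ha

theorem Forall₂.countP_le {α β : Type*} {R : α → β → Prop} {p : α → Bool} {q : β → Bool}
    {l : List α} {m : List β} (h : Forall₂ R l m) (hpq : ∀ a, ∀ b ∈ m, R a b → p a → q b) :
    l.countP p ≤ m.countP q := by
  induction h with
  | nil => simp
  | cons hab _ ih =>
    have := hpq _ _ mem_cons_self hab
    have := ih fun a b hb => hpq a b (mem_cons_of_mem _ hb)
    simp only [countP_cons]
    split_ifs <;> first | omega | simp_all

theorem exists_append_cons_append_cons_of_two_le_countP {α : Type*} {p : α → Bool} {l : List α}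
    (h : 2 ≤ l.countP p) :
    ∃ l₁ a l₂ b l₃, l = l₁ ++ a :: (l₂ ++ b :: l₃) ∧ p a ∧ p b := by
  obtain ⟨a, l₁, l₂, -, ha, rfl, -⟩ : ∃ a l₁ l₂, (∀ x ∈ l₁, ¬ p x) ∧ p a ∧
      l = l₁ ++ a :: l₂ ∧ l.eraseP p = l₁ ++ l₂ := by
    obtain ⟨x, hx, hpx⟩ := countP_pos_iff.1 (lt_of_lt_of_le two_pos h)
    exact exists_of_eraseP hx hpx
  rw [countP_append, countP_cons_of_pos ha] at h
  by_cases h₂ : 0 < l₂.countP p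
  · obtain ⟨b, hb, hpb⟩ := countP_pos_iff.1 h₂
    obtain ⟨s, t, rfl⟩ := append_of_mem hb
    exact ⟨l₁, a, s, b, t, rfl, ha, hpb⟩
  · obtain ⟨b, hb, hpb⟩ := countP_pos_iff.1 (show 0 < l₁.countP p by omega)
    obtain ⟨s, t, rfl⟩ := append_of_mem hb
    exact ⟨s, b, t, a, l₂, by simp, hpb, ha⟩

end List

namespace RawTree

variable {V A : Type} {G : CFG V A}

theorem induction_on_children {motive : RawTree V A → Prop}
    (h : ∀ X rhs cs, (∀ c ∈ cs, motive c) → motive (node X rhs cs)) : ∀ t, motive t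
  | node X rhs cs => h X rhs cs fun c _ => induction_on_children h c

theorem isDTree_node_iff {X Y : V} {rhs : List (A ⊕ V)} {cs : List (RawTree V A)} :
    IsDTree G X (node Y rhs cs) ↔
      X = Y ∧ (Y, rhs) ∈ G.P ∧ List.Forall₂ (IsDTree G) (varsOf rhs) cs := by
  constructor
  · rintro ⟨hP, hch⟩
    exact ⟨rfl, hP, hch⟩
  · rintro ⟨rfl, hP, hch⟩
    exact ⟨hP, hch⟩

/-- Replacing one child of a derivation tree by another tree with the same root variable. -/
theorem isDTree_node_append_cons {X Y : V} {rhs : List (A ⊕ V)} {l₁ l₂ : List (RawTree V A)}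
    {c : RawTree V A} (h : IsDTree G X (node Y rhs (l₁ ++ c :: l₂))) :
    ∃ Z, IsDTree G Z c ∧
      ∀ c', IsDTree G Z c' → IsDTree G X (node Y rhs (l₁ ++ c' :: l₂)) := by
  obtain ⟨rfl, hP, hch⟩ := isDTree_node_iff.1 h
  obtain ⟨k₁, Z, k₂, hk, h₁, hc, h₂⟩ := List.forall₂_append_cons_iff.1 hch
  exact ⟨Z, hc, fun c' hc' => isDTree_node_iff.2
    ⟨rfl, hP, List.forall₂_append_cons_iff.2 ⟨k₁, Z, k₂, hk, h₁, hc', h₂⟩⟩⟩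

/-- The multiset of productions labelling the nodes of a tree. -/
def prods : RawTree V A → Multiset (V × List (A ⊕ V))
  | .node X rhs cs => {(X, rhs)} + (cs.attach.map (fun c => prods c.1)).sum
decreasing_by have := List.sizeOf_lt_of_mem c.2; simp; omega

theorem prods_node (X : V) (rhs : List (A ⊕ V)) (cs : List (RawTree V A)) :
    prods (node X rhs cs) = {(X, rhs)} + (cs.map prods).sum := by
  rw [prods, List.attach_map_val (f := prods)]

theorem yield_node (X : V) (rhs : List (A ⊕ V)) (cs : List (RawTree V A)) :
    yield (node X rhs cs) = yieldAux rhs (cs.map yield) := by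
  rw [yield, List.attach_map_val (f := yield)]

theorem dim_node (X : V) (rhs : List (A ⊕ V)) (cs : List (RawTree V A)) :
    dim (node X rhs cs) = if (cs.map dim).isEmpty then 0 else
      if (cs.map dim).count ((cs.map dim).foldr max 0) = 1 then (cs.map dim).foldr max 0
      else (cs.map dim).foldr max 0 + 1 := by
  rw [dim]
  simp only [List.attach_map_val (f := dim)]

theorem foldr_max_le_iff {l : List ℕ} {d : ℕ} : l.foldr max 0 ≤ d ↔ ∀ x ∈ l, x ≤ d := by
  induction l <;> simp_all

theorem foldr_max_mem {l : List ℕ} (h : l ≠ []) : l.foldr max 0 ∈ l := by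
  induction l with
  | nil => simp at h
  | cons a l ih =>
    rcases eq_or_ne l [] with rfl | hl
    · simp
    · rcases max_cases a (l.foldr max 0) with ⟨h, -⟩ | ⟨h, -⟩ <;> simp [h, ih hl]

theorem dim_node_le_iff {X : V} {rhs : List (A ⊕ V)} {cs : List (RawTree V A)} {d : ℕ} :
    dim (node X rhs cs) ≤ d ↔ (∀ c ∈ cs, dim c ≤ d) ∧ cs.countP (dim · = d) ≤ 1 := by
  have key : ∀ l : List ℕ, (if l.isEmpty then 0 else
      if l.count (l.foldr max 0) = 1 then l.foldr max 0 else l.foldr max 0 + 1) ≤ d ↔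
      (∀ x ∈ l, x ≤ d) ∧ l.count d ≤ 1 := by
    intro l
    rcases eq_or_ne l [] with rfl | hl
    · simp
    have hm := foldr_max_mem hl
    have hle := foldr_max_le_iff (l := l) (d := d)
    have hpos := List.count_pos_iff.2 hm
    rw [← hle]
    simp only [List.isEmpty_iff, hl, if_false]
    rcases lt_trichotomy (l.foldr max 0) d with h | h | h
    · have : l.count d = 0 := by
        rw [List.count_eq_zero]
        intro hd
        exact absurd (foldr_max_le_iff.1 le_rfl d hd) (by omega)
      split_ifs <;> omega
    · rw [← h]
      split_ifs <;> omega
    · split_ifs <;> omega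
  rw [dim_node, key]
  simp [List.count, List.countP_map, Function.comp_def, beq_eq_decide]

theorem dim_le_dim_node {X : V} {rhs : List (A ⊕ V)} {cs : List (RawTree V A)}
    {c : RawTree V A} (hc : c ∈ cs) : dim c ≤ dim (node X rhs cs) :=
  (dim_node_le_iff.1 le_rfl).1 c hc

theorem prods_le_prods_node {X : V} {rhs : List (A ⊕ V)} {cs : List (RawTree V A)}
    {c : RawTree V A} (hc : c ∈ cs) : {(X, rhs)} + prods c ≤ prods (node X rhs cs) := by
  rw [prods_node]
  gcongr
  exact List.single_le_sum (fun _ _ => zero_le) _ (List.mem_map_of_mem hc)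

theorem card_prods_lt_card_prods_node {X : V} {rhs : List (A ⊕ V)} {cs : List (RawTree V A)}
    {c : RawTree V A} (hc : c ∈ cs) : (prods c).card < (prods (node X rhs cs)).card := by
  have := Multiset.card_le_card (prods_le_prods_node (X := X) (rhs := rhs) hc)
  simp at this
  omega

open Classical in
/-- The set of variables occurring as left-hand sides of the labels of a tree. -/
noncomputable def vars (t : RawTree V A) : Finset V := ((prods t).map Prod.fst).toFinset

theorem vars_mono {s t : RawTree V A} (h : prods s ≤ prods t) : vars s ⊆ vars t := by
  classical
  exact Multiset.toFinset_subset.2 (Multiset.subset_of_le (Multiset.map_le_map h))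

theorem vars_congr {s t : RawTree V A} (h : prods s = prods t) : vars s = vars t := by
  rw [vars, vars, h]

theorem mem_vars_node {X Y : V} {rhs : List (A ⊕ V)} {cs : List (RawTree V A)} :
    Y ∈ vars (node X rhs cs) ↔ Y = X ∨ ∃ c ∈ cs, Y ∈ vars c := by
  classical
  have key : ∀ l : List (RawTree V A), Y ∈ Multiset.map Prod.fst (l.map prods).sum ↔
      ∃ c ∈ l, Y ∈ Multiset.map Prod.fst (prods c) := by
    intro l
    induction l with
    | nil => simp
    | cons a l ih =>
      rw [List.map_cons, List.sum_cons, Multiset.map_add, Multiset.mem_add, ih]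
      simp only [List.mem_cons, exists_eq_or_imp]
  simp only [vars, Multiset.mem_toFinset, prods_node, Multiset.map_add, Multiset.mem_add, key]
  simp

theorem vars_subset_vars_node {X : V} {rhs : List (A ⊕ V)} {cs : List (RawTree V A)}
    {c : RawTree V A} (hc : c ∈ cs) : vars c ⊆ vars (node X rhs cs) :=
  fun _ hY => mem_vars_node.2 (.inr ⟨c, hc, hY⟩)

/-- The Parikh image of the terminals in a sentential form. -/
noncomputable def terminalParikh (rhs : List (A ⊕ V)) : A →₀ ℕ :=
  parikh (rhs.filterMap Sum.getLeft?)

theorem parikh_cons (a : A) (w : List A) : parikh (a :: w) = Finsupp.single a 1 + parikh w := by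
  simp [parikh]

theorem parikh_append (w w' : List A) : parikh (w ++ w') = parikh w + parikh w' := by
  simp [parikh]

theorem parikh_yieldAux {rhs : List (A ⊕ V)} {ys : List (List A)}
    (h : (varsOf rhs).length = ys.length) :
    parikh (yieldAux rhs ys) = terminalParikh rhs + (ys.map parikh).sum := by
  induction rhs generalizing ys with
  | nil =>
    obtain rfl : ys = [] := by simpa [varsOf, eq_comm] using h
    simp [yieldAux, terminalParikh]
  | cons x rest ih =>
    rcases x with a | Z
    · have := ih (ys := ys) (by simpa [varsOf, List.filterMap_cons] using h)
      simp only [yieldAux, parikh_cons, this, terminalParikh]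
      simp [parikh_cons, add_assoc]
    · rcases ys with _ | ⟨y, ys⟩
      · simp [varsOf] at h
      · have := ih (ys := ys) (by simpa [varsOf, List.filterMap_cons] using h)
        simp only [yieldAux, parikh_append, this, terminalParikh]
        simp [add_left_comm, List.filterMap_cons]

theorem parikh_yield {X : V} {t : RawTree V A} (h : IsDTree G X t) :
    parikh (yield t) = ((prods t).map fun p => terminalParikh p.2).sum := by
  induction t using induction_on_children generalizing X with
  | h Y rhs cs ih =>
    obtain ⟨rfl, -, hch⟩ := isDTree_node_iff.1 h
    rw [yield_node, parikh_yieldAux (by simpa using hch.length_eq), prods_node]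
    have key : ∀ l : List (RawTree V A), (∀ c ∈ l, ∃ Z, IsDTree G Z c) → (∀ c ∈ l, c ∈ cs) →
        ((l.map yield).map parikh).sum =
          ((l.map prods).sum.map fun p => terminalParikh p.2).sum := by
      intro l hl hlc
      induction l with
      | nil => simp
      | cons c l ihl =>
        obtain ⟨Z, hZ⟩ := hl c (by simp)
        have h₁ := ihl (fun c hc => hl c (by simp [hc])) (fun c hc => hlc c (by simp [hc]))
        have h₂ := ih c (hlc c (by simp)) hZ
        simp only [List.map_cons, List.sum_cons, Multiset.map_add, Multiset.sum_add, h₁, h₂]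
    rw [key cs (fun c hc => ?_) fun _ => id]
    · simp
    · obtain ⟨Z, -, hZ⟩ := hch.exists_left_of_mem hc
      exact ⟨Z, hZ⟩

theorem parikh_yield_congr {X : V} {s t : RawTree V A} (hs : IsDTree G X s) (ht : IsDTree G X t)
    (h : prods s = prods t) : parikh (yield s) = parikh (yield t) := by
  rw [parikh_yield hs, parikh_yield ht, h]

theorem exists_replaceable_of_mem_vars {X Y : V} {t : RawTree V A} (ht : IsDTree G X t)
    (hY : Y ∈ vars t) :
    ∃ q, IsDTree G Y q ∧ prods q ≤ prods t ∧ ∀ q', IsDTree G Y q' →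
      ∃ t', IsDTree G X t' ∧ prods t' + prods q = prods t + prods q' := by
  induction t using induction_on_children generalizing X with
  | h Z rhs cs ih =>
    obtain rfl := (isDTree_node_iff.1 ht).1
    rcases mem_vars_node.1 hY with rfl | ⟨c, hc, hYc⟩
    · exact ⟨_, ht, le_rfl, fun q' hq' => ⟨q', hq', add_comm _ _⟩⟩
    obtain ⟨l₁, l₂, rfl⟩ := List.append_of_mem hc
    obtain ⟨Z, hcZ, hrep⟩ := isDTree_node_append_cons ht
    obtain ⟨q, hq, hle, hq'⟩ := ih c hc hcZ hYc
    refine ⟨q, hq, ?_, fun q' hqq' => ?_⟩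
    · exact hle.trans ((Multiset.le_add_left _ _).trans (prods_le_prods_node hc))
    · obtain ⟨c', hc', hcc'⟩ := hq' q' hqq'
      refine ⟨_, hrep c' hc', ?_⟩
      simp only [prods_node, List.map_append, List.map_cons, List.sum_append, List.sum_cons]
      calc _ = {(X, rhs)} + ((l₁.map prods).sum + (l₂.map prods).sum) +
            (prods c' + prods q) := by abel
        _ = _ := by rw [hcc']; abel

/-- Either the dimension of a tree is less than its number of variables, or a nonempty pump can
be cut out of the tree and inserted at any occurrence of its variable. -/
theorem dim_lt_card_vars_or_exists_pump {X : V} {s : RawTree V A} (hs : IsDTree G X s) :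
    dim s < (vars s).card ∨ ∃ Y ∈ vars s, ∃ M : Multiset (V × List (A ⊕ V)), M ≠ 0 ∧
      (∃ s', IsDTree G X s' ∧ prods s' + M = prods s) ∧
      ∀ h, IsDTree G Y h → ∃ h', IsDTree G Y h' ∧ prods h' = prods h + M := by
  induction s using induction_on_children generalizing X with
  | h Z rhs cs ih =>
    obtain rfl := (isDTree_node_iff.1 hs).1
    by_cases hrep : ∃ c ∈ cs, X ∈ vars c
    · obtain ⟨c, hc, hX⟩ := hrep
      obtain ⟨l₁, l₂, rfl⟩ := List.append_of_mem hc
      obtain ⟨Z, hcZ, hrepl⟩ := isDTree_node_append_cons hs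
      obtain ⟨q, hq, hle, hq'⟩ := exists_replaceable_of_mem_vars hcZ hX
      obtain ⟨D, hD⟩ := Multiset.le_iff_exists_add.1 hle
      refine .inr ⟨X, mem_vars_node.2 (.inl rfl),
        {(X, rhs)} + ((l₁.map prods).sum + (l₂.map prods).sum) + D, ?_, ⟨q, hq, ?_⟩, ?_⟩
      · simp
      · simp only [prods_node, List.map_append, List.map_cons, List.sum_append, List.sum_cons, hD]
        abel
      · intro h hh
        obtain ⟨c', hc', hcc'⟩ := hq' h hh
        refine ⟨_, hrepl c' hc', ?_⟩
        have : prods c' = D + prods h := by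
          apply add_right_cancel (b := prods q)
          rw [hcc', hD]
          abel
        simp only [prods_node, List.map_append, List.map_cons, List.sum_append, List.sum_cons,
          this]
        abel
    by_cases hch : ∀ c ∈ cs, dim c < (vars c).card
    · left
      push Not at hrep
      have hlt : ∀ c ∈ cs, (vars c).card < (vars (node X rhs cs)).card := fun c hc =>
        Finset.card_lt_card ⟨vars_subset_vars_node hc,
          fun h => hrep c hc (h (mem_vars_node.2 (.inl rfl)))⟩
      have hpos : 0 < (vars (node X rhs cs)).card :=
        Finset.card_pos.2 ⟨X, mem_vars_node.2 (.inl rfl)⟩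
      refine Nat.lt_of_le_pred hpos (dim_node_le_iff.2 ⟨fun c hc => ?_, ?_⟩)
      · have := hlt c hc
        have := hch c hc
        simp only [Nat.pred_eq_sub_one]
        omega
      · rw [List.countP_eq_zero.2]
        · omega
        · intro c hc
          have := hlt c hc
          have := hch c hc
          simp only [Nat.pred_eq_sub_one, decide_eq_true_eq]
          omega
    · right
      push Not at hch
      obtain ⟨c, hc, hdc⟩ := hch
      obtain ⟨l₁, l₂, rfl⟩ := List.append_of_mem hc
      obtain ⟨Z, hcZ, hrepl⟩ := isDTree_node_append_cons hs
      rcases ih c hc hcZ with h | ⟨Y, hY, M, hM, ⟨c', hc', hcM⟩, hins⟩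
      · omega
      · refine ⟨Y, vars_subset_vars_node hc hY, M, hM, ⟨_, hrepl c' hc', ?_⟩, hins⟩
        simp only [prods_node, List.map_append, List.map_cons, List.sum_append, List.sum_cons,
          ← hcM]
        abel

/-- Pumps can be moved from `s` to `h` until the dimension of `s` is small. -/
theorem exists_move_pumps {Z Y : V} {s h : RawTree V A} (hs : IsDTree G Z s)
    (hh : IsDTree G Y h) (hsub : vars s ⊆ vars h) :
    ∃ s' h', IsDTree G Z s' ∧ IsDTree G Y h' ∧ prods s' + prods h' = prods s + prods h ∧
      prods h ≤ prods h' ∧ dim s' < (vars s).card ∧ (prods s').card ≤ (prods s).card ∧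
      ((vars s).card ≤ dim s → (prods s').card < (prods s).card) := by
  induction hN : (prods s).card using Nat.strong_induction_on generalizing s h with
  | _ N ih =>
    subst hN
    rcases dim_lt_card_vars_or_exists_pump hs with hd | ⟨W, hW, M, hM, ⟨s₁, hs₁, hsM⟩, hins⟩
    · exact ⟨s, h, hs, hh, rfl, le_rfl, hd, le_rfl, fun h => absurd h (by omega)⟩
    obtain ⟨q, hq, -, hrep⟩ := exists_replaceable_of_mem_vars hh (hsub hW)
    obtain ⟨q', hq', hqM⟩ := hins q hq
    obtain ⟨h₁, hh₁, heq⟩ := hrep q' hq'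
    have hh₁M : prods h₁ = prods h + M := by
      apply add_right_cancel (b := prods q)
      rw [heq, hqM]
      abel
    have hle : prods h ≤ prods h₁ := hh₁M ▸ Multiset.le_add_right _ _
    have hles : prods s₁ ≤ prods s := hsM ▸ Multiset.le_add_right _ _
    have hlt : (prods s₁).card < (prods s).card := by
      rw [← hsM, Multiset.card_add]
      have := Multiset.card_pos.2 hM
      omega
    obtain ⟨s', h', hs', hh', hsum, hle', hd, hc, -⟩ :=
      ih _ hlt hs₁ hh₁ ((vars_mono hles).trans (hsub.trans (vars_mono hle))) rfl
    refine ⟨s', h', hs', hh', ?_, hle.trans hle',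
      hd.trans_le (Finset.card_le_card (vars_mono hles)), by omega, fun _ => by omega⟩
    rw [hsum, hh₁M, ← hsM]
    abel

/-- `s` is not larger than `t`, and smaller if `t` has dimension at least `d`. -/
def Shrinks (d : ℕ) (s t : RawTree V A) : Prop :=
  (prods s).card ≤ (prods t).card ∧ (d ≤ dim t → (prods s).card < (prods t).card)

theorem exists_move_pumps_list {Y : V} {Zs : List V} {l : List (RawTree V A)} {h : RawTree V A}
    (hl : List.Forall₂ (IsDTree G) Zs l) (hh : IsDTree G Y h) {W : Finset V}
    (hsub : ∀ c ∈ l, vars c ⊆ W) (hW : W ⊆ vars h) :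
    ∃ l' h', List.Forall₂ (IsDTree G) Zs l' ∧ IsDTree G Y h' ∧
      (l'.map prods).sum + prods h' = (l.map prods).sum + prods h ∧
      (∀ c ∈ l', dim c < W.card) ∧
      List.Forall₂ (Shrinks W.card) l' l := by
  induction hl generalizing h with
  | nil => exact ⟨[], h, .nil, hh, rfl, by simp, .nil⟩
  | @cons Z c Zs l hc _ ih =>
    have hcW := hsub c (by simp)
    obtain ⟨c', h₁, hc', hh₁, heq, hle, hd, hcard, hlt⟩ := exists_move_pumps hc hh (hcW.trans hW)
    obtain ⟨l', h', hl', hh', heq', hd', hR⟩ :=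
      ih hh₁ (fun c hc => hsub c (by simp [hc])) (hW.trans (vars_mono hle))
    have hcardW := Finset.card_le_card hcW
    refine ⟨c' :: l', h', .cons hc' hl', hh', ?_, ?_,
      .cons ⟨hcard, fun h => hlt (hcardW.trans h)⟩ hR⟩
    · simp only [List.map_cons, List.sum_cons]
      rw [add_assoc, heq', add_left_comm, heq]
      abel
    · simpa using ⟨hd.trans_le hcardW, hd'⟩

theorem prods_node_append_cons (X : V) (rhs : List (A ⊕ V)) (l₁ l₂ : List (RawTree V A))
    (c : RawTree V A) : prods (node X rhs (l₁ ++ c :: l₂)) =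
      {(X, rhs)} + ((l₁ ++ l₂).map prods).sum + prods c := by
  simp only [prods_node, List.map_append, List.map_cons, List.sum_append, List.sum_cons]
  abel

theorem exists_concentrate {X : V} {rhs : List (A ⊕ V)} {l₁ l₂ : List (RawTree V A)}
    {a : RawTree V A} (ht : IsDTree G X (node X rhs (l₁ ++ a :: l₂)))
    (hW : vars (node X rhs (l₁ ++ a :: l₂)) ⊆ vars a)
    (hred : ∀ c Z, IsDTree G Z c → (prods c).card < (prods (node X rhs (l₁ ++ a :: l₂))).card →
      ∃ c', IsDTree G Z c' ∧ prods c' = prods c ∧ dim c' ≤ (vars c).card) :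
    ∃ l₁' a' l₂', IsDTree G X (node X rhs (l₁' ++ a' :: l₂')) ∧
      prods (node X rhs (l₁' ++ a' :: l₂')) = prods (node X rhs (l₁ ++ a :: l₂)) ∧
      dim (node X rhs (l₁' ++ a' :: l₂')) ≤ (vars (node X rhs (l₁ ++ a :: l₂))).card ∧
      List.Forall₂ (Shrinks (vars (node X rhs (l₁ ++ a :: l₂))).card) l₁' l₁ ∧
      List.Forall₂ (Shrinks (vars (node X rhs (l₁ ++ a :: l₂))).card) l₂' l₂ := by
  set t := node X rhs (l₁ ++ a :: l₂) with htdef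
  obtain ⟨-, hP, hch⟩ := isDTree_node_iff.1 ht
  obtain ⟨k₁, Z, k₂, hk, h₁, ha, h₂⟩ := List.forall₂_append_cons_iff.1 hch
  obtain ⟨m, b, hm, hb, hsum, hdim, hR⟩ := exists_move_pumps_list (List.rel_append h₁ h₂) ha
    (W := vars t) (fun c hc => vars_subset_vars_node (by simp at hc ⊢; tauto)) hW
  obtain ⟨l₁', l₂', rfl, hR₁, hR₂⟩ := List.forall₂_append_right_iff.1 hR
  obtain ⟨k₁', k₂', hkk, hk₁, hk₂⟩ := List.forall₂_append_right_iff.1 hm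
  obtain ⟨rfl, rfl⟩ := List.append_inj hkk
    (by rw [h₁.length_eq, hk₁.length_eq, hR₁.length_eq])
  have hdt : ∀ c, IsDTree G Z c → IsDTree G X (node X rhs (l₁' ++ c :: l₂')) := fun c hc =>
    isDTree_node_iff.2 ⟨rfl, hP, List.forall₂_append_cons_iff.2 ⟨k₁, Z, k₂, hk, hk₁, hc, hk₂⟩⟩
  have hprods : prods (node X rhs (l₁' ++ b :: l₂')) = prods t := by
    rw [htdef, prods_node_append_cons, prods_node_append_cons, add_assoc, hsum, add_assoc]
  have hmem : b ∈ l₁' ++ b :: l₂' := by simp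
  obtain ⟨a', ha', hpa, hda⟩ := hred b Z hb (hprods ▸ card_prods_lt_card_prods_node hmem)
  refine ⟨l₁', a', l₂', hdt a' ha', ?_, ?_, hR₁, hR₂⟩
  · rw [← hprods, prods_node_append_cons, prods_node_append_cons, hpa]
  · have hbt : (vars b).card ≤ (vars t).card := by
      rw [← vars_congr hprods]
      exact Finset.card_le_card (vars_subset_vars_node hmem)
    have h₀ : (l₁' ++ l₂').countP (dim · = (vars t).card) = 0 :=
      List.countP_eq_zero.2 fun c hc => by simpa using (hdim c hc).ne
    refine dim_node_le_iff.2 ⟨fun c hc => ?_, ?_⟩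
    · rcases (show c = a' ∨ c ∈ l₁' ++ l₂' by simp at hc ⊢; tauto) with rfl | hc
      · exact hda.trans hbt
      · exact (hdim c hc).le
    · rw [List.countP_append, List.countP_cons]
      rw [List.countP_append] at h₀
      split_ifs <;> omega

theorem sum_card_prods_le {l' l : List (RawTree V A)} {N : ℕ}
    (h : List.Forall₂ (Shrinks N) l' l) :
    (l'.map prods).sum.card ≤ (l.map prods).sum.card := by
  induction h with
  | nil => simp
  | cons hab _ ih =>
    simp only [List.map_cons, List.sum_cons, Multiset.card_add]
    have := hab.1
    omega

/-- If all children have dimension at most their number of variables but the tree itself does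
not, then concentrating pumps in two different children gives two different trees. -/
theorem exists_two_of_children_reduced {X : V} {rhs : List (A ⊕ V)} {cs : List (RawTree V A)}
    (ht : IsDTree G X (node X rhs cs)) (hcs : ∀ c ∈ cs, dim c ≤ (vars c).card)
    (hdim : (vars (node X rhs cs)).card < dim (node X rhs cs))
    (hred : ∀ c Z, IsDTree G Z c → (prods c).card < (prods (node X rhs cs)).card →
      ∃ c', IsDTree G Z c' ∧ prods c' = prods c ∧ dim c' ≤ (vars c).card) :
    ∃ t₁ t₂, t₁ ≠ t₂ ∧ ∀ t', (t' = t₁ ∨ t' = t₂) → IsDTree G X t' ∧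
      prods t' = prods (node X rhs cs) ∧ dim t' ≤ (vars (node X rhs cs)).card := by
  have hcard : ∀ c ∈ cs, (vars c).card ≤ (vars (node X rhs cs)).card := fun c hc =>
    Finset.card_le_card (vars_subset_vars_node hc)
  have h2 : 2 ≤ cs.countP (dim · = (vars (node X rhs cs)).card) := by
    by_contra h
    exact hdim.not_ge (dim_node_le_iff.2
      ⟨fun c hc => (hcs c hc).trans (hcard c hc), by omega⟩)
  obtain ⟨l₁, a, l₂, b, l₃, rfl, ha, hb⟩ :=
    List.exists_append_cons_append_cons_of_two_le_countP h2
  simp only [decide_eq_true_eq] at ha hb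
  have hvars : ∀ c ∈ l₁ ++ a :: (l₂ ++ b :: l₃),
      dim c = (vars (node X rhs (l₁ ++ a :: (l₂ ++ b :: l₃)))).card →
      vars (node X rhs (l₁ ++ a :: (l₂ ++ b :: l₃))) ⊆ vars c := fun c hc hd =>
    (Finset.eq_of_subset_of_card_le (vars_subset_vars_node hc) (hd ▸ hcs c hc)).ge
  obtain ⟨m₁, a', m₂, hA, hpA, hdA, hA₁, hA₂⟩ :=
    exists_concentrate ht (hvars a (by simp) ha) hred
  have hassoc : l₁ ++ a :: (l₂ ++ b :: l₃) = (l₁ ++ a :: l₂) ++ b :: l₃ := by simp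
  have hvb := hvars b (by simp) hb
  rw [hassoc] at ht hred hvb
  obtain ⟨n₁, b', n₂, hB, hpB, hdB, hB₁, hB₂⟩ := exists_concentrate ht hvb hred
  rw [← hassoc] at hpB hdB hB₁ hB₂
  refine ⟨node X rhs (m₁ ++ a' :: m₂), node X rhs (n₁ ++ b' :: n₂), fun heq => ?_, ?_⟩
  rotate_left
  · rintro t' (rfl | rfl)
    exacts [⟨hA, hpA, hdA⟩, ⟨hB, hpB, hdB⟩]
  obtain ⟨k₁, b'', k₂, rfl, -, hb'', hk₂⟩ := List.forall₂_append_cons_iff.1 hA₂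
  simp only [node.injEq, true_and] at heq
  obtain ⟨j₁, a'', j₂, rfl, hj₁, ha'', hj₂⟩ := List.forall₂_append_cons_iff.1 hB₁
  have hlen : (m₁ ++ a' :: k₁).length = (j₁ ++ a'' :: j₂).length := by
    have h₁ := congrArg List.length heq
    have h₂ := hk₂.length_eq
    have h₃ := hB₂.length_eq
    simp at h₁ ⊢
    omega
  obtain ⟨-, heq⟩ := List.append_inj
    (show (m₁ ++ a' :: k₁) ++ b'' :: k₂ = (j₁ ++ a'' :: j₂) ++ b' :: n₂ by simpa using heq) hlen
  obtain ⟨rfl, rfl⟩ := List.cons_eq_cons.1 heq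
  have h := congrArg Multiset.card hpB
  simp only [prods_node, List.map_append, List.map_cons, List.sum_append, List.sum_cons,
    Multiset.card_add] at h
  have h₁ := ha''.2 ha.ge
  have h₂ := hb''.1
  have h₃ := sum_card_prods_le hj₁
  have h₄ := sum_card_prods_le hj₂
  have h₅ := sum_card_prods_le hB₂
  omega

theorem exists_two_of_card_vars_lt_dim {X : V} {t : RawTree V A} (ht : IsDTree G X t)
    (hdim : (vars t).card < dim t) :
    ∃ t₁ t₂, t₁ ≠ t₂ ∧ ∀ t', (t' = t₁ ∨ t' = t₂) → IsDTree G X t' ∧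
      prods t' = prods t ∧ dim t' ≤ (vars t).card := by
  induction hN : (prods t).card using Nat.strong_induction_on generalizing X t with
  | _ N ih =>
    subst hN
    have hred : ∀ c Z, IsDTree G Z c → (prods c).card < (prods t).card →
        ∃ c', IsDTree G Z c' ∧ prods c' = prods c ∧ dim c' ≤ (vars c).card := by
      intro c Z hc hlt
      rcases le_or_gt (dim c) (vars c).card with h | h
      · exact ⟨c, hc, rfl, h⟩
      · obtain ⟨t₁, _, _, ht₁⟩ := ih _ hlt hc h rfl
        exact ⟨t₁, ht₁ t₁ (.inl rfl)⟩
    obtain ⟨Y, rhs, cs⟩ := t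
    obtain ⟨rfl, hP, hch⟩ := isDTree_node_iff.1 ht
    -- Every tree with reduced children is either reduced itself or has two reduced variants.
    by_cases hex : ∃ cs', IsDTree G X (node X rhs cs') ∧
        prods (node X rhs cs') = prods (node X rhs cs) ∧ (∀ c ∈ cs', dim c ≤ (vars c).card) ∧
        (vars (node X rhs cs)).card < dim (node X rhs cs')
    · obtain ⟨cs', ht', hp, hcs', hd⟩ := hex
      have := exists_two_of_children_reduced ht' hcs' (vars_congr hp ▸ hd) (hp ▸ hred)
      rwa [hp, vars_congr hp] at this
    push Not at hex
    obtain ⟨c, hc, hdc⟩ : ∃ c ∈ cs, (vars c).card < dim c := by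
      by_contra! h
      exact absurd (hex cs ht rfl h) (by omega)
    have hlist : ∀ (Zs : List V) (l : List (RawTree V A)), List.Forall₂ (IsDTree G) Zs l →
        (∀ c ∈ l, c ∈ cs) → ∃ l', List.Forall₂ (IsDTree G) Zs l' ∧
          (l'.map prods).sum = (l.map prods).sum ∧ ∀ c ∈ l', dim c ≤ (vars c).card := by
      intro Zs l hl
      induction hl with
      | nil => exact fun _ => ⟨[], .nil, rfl, by simp⟩
      | @cons Z d Zs l hd _ ihl =>
        intro hmem
        obtain ⟨l', hl', hp, hdl⟩ := ihl fun c hc => hmem c (by simp [hc])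
        obtain ⟨d', hd', hpd, hdd⟩ :=
          hred d Z hd (card_prods_lt_card_prods_node (hmem d (by simp)))
        refine ⟨d' :: l', .cons hd' hl', by simp [hp, hpd], ?_⟩
        simpa using ⟨vars_congr hpd ▸ hdd, hdl⟩
    have hclt := card_prods_lt_card_prods_node (X := X) (rhs := rhs) hc
    obtain ⟨l₁, l₂, rfl⟩ := List.append_of_mem hc
    obtain ⟨k₁, Z, k₂, hk, h₁, hcZ, h₂⟩ := List.forall₂_append_cons_iff.1 hch
    obtain ⟨c₁, c₂, hne, hcc⟩ := ih _ hclt hcZ hdc rfl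
    obtain ⟨m₁, hm₁, hp₁, hd₁⟩ := hlist k₁ l₁ h₁ (by simp +contextual)
    obtain ⟨m₂, hm₂, hp₂, hd₂⟩ := hlist k₂ l₂ h₂ (by simp +contextual)
    have key : ∀ c', (c' = c₁ ∨ c' = c₂) → IsDTree G X (node X rhs (m₁ ++ c' :: m₂)) ∧
        prods (node X rhs (m₁ ++ c' :: m₂)) = prods (node X rhs (l₁ ++ c :: l₂)) ∧
        dim (node X rhs (m₁ ++ c' :: m₂)) ≤ (vars (node X rhs (l₁ ++ c :: l₂))).card := by
      intro c' hc'
      obtain ⟨hcZ', hpc, hdc'⟩ := hcc c' hc'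
      have hdt : IsDTree G X (node X rhs (m₁ ++ c' :: m₂)) := isDTree_node_iff.2
        ⟨rfl, hP, List.forall₂_append_cons_iff.2 ⟨k₁, Z, k₂, hk, hm₁, hcZ', hm₂⟩⟩
      have hp : prods (node X rhs (m₁ ++ c' :: m₂)) = prods (node X rhs (l₁ ++ c :: l₂)) := by
        simp only [prods_node_append_cons, List.map_append, List.sum_append, hp₁, hp₂, hpc]
      refine ⟨hdt, hp, hex _ hdt hp fun d hd => ?_⟩
      rcases (show d ∈ m₁ ∨ d = c' ∨ d ∈ m₂ by simpa using hd) with hd | rfl | hd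
      · exact hd₁ d hd
      · exact vars_congr hpc ▸ hdc'
      · exact hd₂ d hd
    refine ⟨node X rhs (m₁ ++ c₁ :: m₂), node X rhs (m₁ ++ c₂ :: m₂), by simpa using hne, ?_⟩
    rintro t' (rfl | rfl)
    exacts [key c₁ (.inl rfl), key c₂ (.inr rfl)]

/-- A lower bound for the number of trees of dimension at most `max n (d - 1)` obtained from a
tree of dimension `d`. -/
def numReduced (n d : ℕ) : ℕ := if d ≤ n then 1 else 2 ^ 2 ^ (d - n - 1)

theorem numReduced_pos (n d : ℕ) : 0 < numReduced n d := by
  unfold numReduced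
  split_ifs <;> positivity

theorem numReduced_succ {n d : ℕ} (h : n < d) :
    numReduced n (d + 1) = numReduced n d * numReduced n d := by
  rw [numReduced, numReduced, if_neg (by omega), if_neg (by omega), ← pow_add, ← two_mul,
    ← pow_succ', show d + 1 - n - 1 = d - n - 1 + 1 by omega]

theorem numReduced_dim_node_le {n : ℕ} {X : V} {rhs : List (A ⊕ V)} {cs : List (RawTree V A)}
    (hd : n + 2 ≤ dim (node X rhs cs)) :
    numReduced n (dim (node X rhs cs)) ≤ (cs.map fun c => numReduced n (dim c)).prod := by
  have hpos : 0 < (cs.map fun c => numReduced n (dim c)).prod :=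
    List.prod_pos fun x hx => by
      obtain ⟨c, -, rfl⟩ := List.mem_map.1 hx
      exact numReduced_pos _ _
  obtain ⟨e, he⟩ : ∃ e, dim (node X rhs cs) = e + 1 := ⟨dim (node X rhs cs) - 1, by omega⟩
  have hnot : ¬ dim (node X rhs cs) ≤ e := by omega
  have hle : ∀ c ∈ cs, dim c ≤ e + 1 := fun c hc => he ▸ dim_le_dim_node hc
  rw [dim_node_le_iff] at hnot
  rw [he]
  by_cases hex : ∃ c ∈ cs, dim c = e + 1
  · obtain ⟨c, hc, hce⟩ := hex
    exact Nat.le_of_dvd hpos (List.dvd_prod (List.mem_map.2 ⟨c, hc, by rw [hce]⟩))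
  · push Not at hex
    have h2 : 2 ≤ cs.countP (dim · = e) := by
      by_contra h
      exact hnot ⟨fun c hc => by have := hle c hc; have := hex c hc; omega, by omega⟩
    obtain ⟨l₁, a, l₂, b, l₃, rfl, ha, hb⟩ :=
      List.exists_append_cons_append_cons_of_two_le_countP h2
    simp only [decide_eq_true_eq] at ha hb
    refine Nat.le_of_dvd hpos ?_
    rw [numReduced_succ (by omega)]
    simp only [List.map_append, List.map_cons, List.prod_append, List.prod_cons, ha, hb]
    exact ⟨(l₁.map fun c => numReduced n (dim c)).prod *
      ((l₂.map fun c => numReduced n (dim c)).prod *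
      (l₃.map fun c => numReduced n (dim c)).prod), by ring⟩

theorem dim_node_le_of_reduced {n : ℕ} {X : V} {rhs : List (A ⊕ V)}
    {cs cs' : List (RawTree V A)} (hd : n + 2 ≤ dim (node X rhs cs))
    (h : List.Forall₂ (fun c' c => dim c' ≤ max n (dim c - 1)) cs' cs) :
    dim (node X rhs cs') ≤ dim (node X rhs cs) - 1 := by
  refine dim_node_le_iff.2 ⟨fun c' hc' => ?_, ?_⟩
  · obtain ⟨c, hc, hle⟩ := h.exists_right_of_mem hc'
    have := dim_le_dim_node (X := X) (rhs := rhs) hc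
    omega
  · refine le_trans (h.countP_le (q := (dim · = dim (node X rhs cs))) ?_) ?_
    · intro c' c hc hle hc'
      have := dim_le_dim_node (X := X) (rhs := rhs) hc
      simp only [decide_eq_true_eq] at hc' ⊢
      omega
    · exact (dim_node_le_iff.1 le_rfl).2

theorem exists_finset_reduced [Fintype V] {X : V} {t : RawTree V A} (ht : IsDTree G X t) :
    ∃ S : Finset (RawTree V A), numReduced (Fintype.card V) (dim t) ≤ S.card ∧
      ∀ t' ∈ S, IsDTree G X t' ∧ prods t' = prods t ∧
        dim t' ≤ max (Fintype.card V) (dim t - 1) := by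
  classical
  set n := Fintype.card V with hn
  induction t using induction_on_children generalizing X with
  | h Y rhs cs ih =>
    obtain ⟨rfl, hP, hch⟩ := isDTree_node_iff.1 ht
    rcases le_or_gt (dim (node X rhs cs)) n with hd | hd
    · refine ⟨{node X rhs cs}, by simp [numReduced, hd], fun t' ht' => ?_⟩
      obtain rfl := Finset.mem_singleton.1 ht'
      exact ⟨ht, rfl, hd.trans (le_max_left _ _)⟩
    rcases Nat.eq_or_lt_of_le (Nat.succ_le_of_lt hd) with hd' | hd'
    · have hv : (vars (node X rhs cs)).card ≤ n := Finset.card_le_univ _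
      obtain ⟨t₁, t₂, hne, h⟩ := exists_two_of_card_vars_lt_dim ht (hv.trans_lt hd)
      refine ⟨{t₁, t₂}, ?_, fun t' ht' => ?_⟩
      · simp [numReduced, ← hd', Finset.card_pair hne]
      · obtain ⟨h₁, h₂, h₃⟩ := h t' (by simpa using ht')
        exact ⟨h₁, h₂, h₃.trans (hv.trans (le_max_left _ _))⟩
    have hlist : ∀ (Zs : List V) (l : List (RawTree V A)), List.Forall₂ (IsDTree G) Zs l →
        (∀ c ∈ l, c ∈ cs) → ∃ S : Finset (List (RawTree V A)),
          (l.map fun c => numReduced n (dim c)).prod ≤ S.card ∧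
          ∀ l' ∈ S, List.Forall₂ (IsDTree G) Zs l' ∧ (l'.map prods).sum = (l.map prods).sum ∧
            List.Forall₂ (fun c' c => dim c' ≤ max n (dim c - 1)) l' l := by
      intro Zs l hl
      induction hl with
      | nil =>
        refine fun _ => ⟨{[]}, by simp, fun l' hl' => ?_⟩
        obtain rfl := Finset.mem_singleton.1 hl'
        exact ⟨.nil, rfl, .nil⟩
      | @cons Z d Zs l hdZ _ ihl =>
        intro hmem
        obtain ⟨S, hS, hSl⟩ := ihl fun c hc => hmem c (by simp [hc])
        obtain ⟨T, hT, hTd⟩ := ih d (hmem d (by simp)) hdZ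
        refine ⟨(T ×ˢ S).image fun p => p.1 :: p.2, ?_, fun l' hl' => ?_⟩
        · rw [Finset.card_image_of_injective, Finset.card_product, List.map_cons, List.prod_cons]
          · exact Nat.mul_le_mul hT hS
          · rintro ⟨a, b⟩ ⟨a', b'⟩ h
            simpa using h
        · obtain ⟨⟨d', m⟩, hp, rfl⟩ := Finset.mem_image.1 hl'
          obtain ⟨hd', hm⟩ := Finset.mem_product.1 hp
          obtain ⟨h₁, h₂, h₃⟩ := hTd d' hd'
          obtain ⟨g₁, g₂, g₃⟩ := hSl m hm
          exact ⟨.cons h₁ g₁, by simp [h₂, g₂], .cons h₃ g₃⟩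
    obtain ⟨S, hS, hSl⟩ := hlist _ cs hch fun _ => id
    refine ⟨S.image (node X rhs), ?_, fun t' ht' => ?_⟩
    · rw [Finset.card_image_of_injective _ fun a b h => by simpa using h]
      exact (numReduced_dim_node_le hd').trans hS
    · obtain ⟨cs', hcs', rfl⟩ := Finset.mem_image.1 ht'
      obtain ⟨h₁, h₂, h₃⟩ := hSl cs' hcs'
      exact ⟨isDTree_node_iff.2 ⟨rfl, hP, h₁⟩, by simp [prods_node, h₂],
        (dim_node_le_of_reduced hd' h₃).trans (le_max_right _ _)⟩

theorem exists_finset_of_lt_dim [Fintype V] {X : V} {t : RawTree V A} (ht : IsDTree G X t)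
    {k : ℕ} (hd : Fintype.card V + k < dim t) :
    ∃ S : Finset (RawTree V A), 2 ^ 2 ^ k ≤ S.card ∧
      ∀ t' ∈ S, IsDTree G X t' ∧ prods t' = prods t ∧ dim t' ≤ Fintype.card V + k := by
  induction hN : dim t using Nat.strong_induction_on generalizing t with
  | _ N ih =>
    subst hN
    obtain ⟨S, hS, hSt⟩ := exists_finset_reduced ht
    by_cases hex : ∃ t' ∈ S, Fintype.card V + k < dim t'
    · obtain ⟨t', ht', hdt⟩ := hex
      obtain ⟨h₁, h₂, h₃⟩ := hSt t' ht'
      rw [← h₂]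
      exact ih _ (by omega) h₁ hdt rfl
    · push Not at hex
      refine ⟨S, le_trans ?_ hS, fun t' ht' =>
        ⟨(hSt t' ht').1, (hSt t' ht').2.1, hex t' ht'⟩⟩
      rw [numReduced, if_neg (by omega)]
      gcongr <;> omega

end RawTree

/-- Convergence speed: with `n = |V|`, for every `k` and Parikh vector `v`, the number
of `(G,X)`-derivation trees `t` with `π(Y(t)) = v` and `dim(t) ≤ n + k` is at least
`min(camb_{G,X}(v), 2^(2^k))`. -/
theorem camb_convergence {V A : Type} [Fintype V] [Fintype A]
    (G : CFG V A) (hGfin : G.P.Finite) (X : V) (k : ℕ) (v : A →₀ ℕ) :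
    min (camb G X v) ((2 : ℕ∞) ^ (2 ^ k)) ≤
      Set.encard {t : RawTree V A | IsDTree G X t ∧ parikh (yield t) = v ∧
        dim t ≤ Fintype.card V + k} := by
  by_cases hex : ∃ t, IsDTree G X t ∧ parikh (yield t) = v ∧ Fintype.card V + k < dim t
  · obtain ⟨t, ht, rfl, hd⟩ := hex
    obtain ⟨S, hS, hSt⟩ := exists_finset_of_lt_dim ht hd
    refine (min_le_right _ _).trans (le_trans ?_ (Set.encard_le_encard (s := (S : Set _)) ?_))
    · rw [Set.encard_coe_eq_coe_finsetCard]
      exact_mod_cast hS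
    · intro t' ht'
      obtain ⟨h₁, h₂, h₃⟩ := hSt t' ht'
      exact ⟨h₁, parikh_yield_congr h₁ ht h₂, h₃⟩
  · push Not at hex
    exact (min_le_left _ _).trans
      (Set.encard_le_encard fun t ht => ⟨ht.1, ht.2, hex t ht.1 ht.2⟩)
end

section
/- Let G = (V, Σ, P) be a context-free grammar and X ∈ V. The language {w ∈ Σ* : amb_{G,X}(w) = ∞} of words having infinitely many (G,X)-derivation trees is context-free; i.e., there exists a context-free grammar G′ over Σ with a start variable generating exactly this language. -/
open RawTree

namespace CFG

variable {V A : Type}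

/-- `Gen G s w`: the sentential form `s` generates the terminal word `w`, structurally. -/
inductive Gen (G : CFG V A) : List (A ⊕ V) → List A → Prop
  | nil : Gen G [] []
  | terminal (a : A) {s : List (A ⊕ V)} {w : List A} (hs : Gen G s w) :
      Gen G (Sum.inl a :: s) (a :: w)
  | var {X : V} {rhs s : List (A ⊕ V)} {u v : List A} (hP : (X, rhs) ∈ G.P)
      (hr : Gen G rhs u) (hs : Gen G s v) : Gen G (Sum.inr X :: s) (u ++ v)

namespace Gen

variable {G : CFG V A}

theorem map_inl (w : List A) : Gen G (w.map Sum.inl) w := by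
  induction w with
  | nil => exact .nil
  | cons a w ih => exact .terminal a ih

theorem append {s t : List (A ⊕ V)} {u v : List A} (hs : Gen G s u) (ht : Gen G t v) :
    Gen G (s ++ t) (u ++ v) := by
  induction hs with
  | nil => exact ht
  | terminal a _ ih => exact .terminal a ih
  | var hP hr _ _ ih => rw [List.append_assoc]; exact .var hP hr ih

theorem exists_of_append {s t : List (A ⊕ V)} {w : List A} (h : Gen G (s ++ t) w) :
    ∃ u v, w = u ++ v ∧ Gen G s u ∧ Gen G t v := by
  induction s generalizing w with
  | nil => exact ⟨[], w, rfl, .nil, h⟩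
  | cons c s ih =>
    cases h with
    | terminal a hs =>
      obtain ⟨u, v, rfl, hu, hv⟩ := ih hs
      exact ⟨a :: u, v, rfl, .terminal a hu, hv⟩
    | @var X rhs _ u' v' hP hr hs =>
      obtain ⟨u, v, rfl, hu, hv⟩ := ih hs
      exact ⟨u' ++ u, v, (List.append_assoc ..).symm, .var hP hr hu, hv⟩

theorem of_produces {s t : List (A ⊕ V)} {w : List A} (h : Produces G s t) (ht : Gen G t w) :
    Gen G s w := by
  obtain ⟨pre, post, X, rhs, hP, rfl, rfl⟩ := h
  obtain ⟨uv, x, rfl, huv, hx⟩ := ht.exists_of_append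
  obtain ⟨u, v, rfl, hu, hv⟩ := huv.exists_of_append
  rw [List.append_assoc]
  exact hu.append (.var hP hv hx)

end Gen

theorem Produces.append_context {G : CFG V A} {s t : List (A ⊕ V)} (p q : List (A ⊕ V))
    (h : Produces G s t) : Produces G (p ++ s ++ q) (p ++ t ++ q) := by
  obtain ⟨pre, post, X, rhs, hP, rfl, rfl⟩ := h
  exact ⟨p ++ pre, post ++ q, X, rhs, hP, by simp, by simp⟩

theorem Derives.append_context {G : CFG V A} {s t : List (A ⊕ V)} (p q : List (A ⊕ V))
    (h : Derives G s t) : Derives G (p ++ s ++ q) (p ++ t ++ q) :=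
  Relation.ReflTransGen.lift (fun s => p ++ s ++ q)
    (fun _ _ h => Produces.append_context p q h) _ _ h

theorem derives_iff_gen {G : CFG V A} {s : List (A ⊕ V)} {w : List A} :
    Derives G s (w.map Sum.inl) ↔ Gen G s w := by
  constructor
  · intro h
    induction h using Relation.ReflTransGen.head_induction_on with
    | refl => exact Gen.map_inl w
    | head h _ ih => exact ih.of_produces h
  · intro h
    induction h with
    | nil => exact .refl
    | terminal a _ ih => simpa using Derives.append_context [Sum.inl a] [] ih
    | @var X rhs s u v hP _ _ ihr ihs =>
      have h₁ : Produces G (Sum.inr X :: s) (rhs ++ s) := ⟨[], s, X, rhs, hP, rfl, rfl⟩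
      have h₂ : Derives G (rhs ++ s) (u.map Sum.inl ++ s) := by
        simpa using Derives.append_context [] s ihr
      have h₃ : Derives G (u.map Sum.inl ++ s) (u.map Sum.inl ++ v.map Sum.inl) := by
        simpa using Derives.append_context (u.map Sum.inl) [] ihs
      rw [List.map_append]
      exact .head h₁ (h₂.trans h₃)

/-- The `(G,X)`-trees with yield `w`. -/
def trees (G : CFG V A) (X : V) (w : List A) : Set (RawTree V A) :=
  {t | IsDTree G X t ∧ yield t = w}

/-- The lists of derivation trees, one for each variable occurrence of `s`, which together with
the terminals of `s` yield `w`. -/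
def forests (G : CFG V A) (s : List (A ⊕ V)) (w : List A) : Set (List (RawTree V A)) :=
  {cs | List.Forall₂ (IsDTree G) (varsOf s) cs ∧ yieldAux s (cs.map yield) = w}

theorem yield_node (X : V) (rhs : List (A ⊕ V)) (cs : List (RawTree V A)) :
    yield (.node X rhs cs) = yieldAux rhs (cs.map yield) := by
  rw [RawTree.yield, List.attach_map_val (f := yield)]

variable {G : CFG V A}

theorem node_mem_trees {X Y : V} {rhs : List (A ⊕ V)} {cs : List (RawTree V A)} {w : List A} :
    RawTree.node Y rhs cs ∈ trees G X w ↔ Y = X ∧ (X, rhs) ∈ G.P ∧ cs ∈ forests G rhs w := by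
  constructor
  · rintro ⟨h, hw⟩
    cases h with
    | node hP hch => exact ⟨rfl, hP, hch, by rw [← hw, yield_node]⟩
  · rintro ⟨rfl, hP, hch, hw⟩
    exact ⟨.node hP hch, by rw [yield_node, hw]⟩

theorem mem_forests_nil {cs : List (RawTree V A)} {w : List A} :
    cs ∈ forests G [] w ↔ cs = [] ∧ w = [] := by
  simp [forests, varsOf, yieldAux, eq_comm]

theorem mem_forests_inl {a : A} {s : List (A ⊕ V)} {cs : List (RawTree V A)} {w : List A} :
    cs ∈ forests G (Sum.inl a :: s) w ↔ ∃ v, w = a :: v ∧ cs ∈ forests G s v := by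
  have hvars : varsOf (Sum.inl a :: s : List (A ⊕ V)) = varsOf s := rfl
  simp only [forests, hvars, yieldAux, Set.mem_ofPred_eq]
  constructor
  · rintro ⟨h, rfl⟩
    exact ⟨_, rfl, h, rfl⟩
  · rintro ⟨v, rfl, h, rfl⟩
    exact ⟨h, rfl⟩

theorem mem_forests_inr {X : V} {s : List (A ⊕ V)} {cs : List (RawTree V A)} {w : List A} :
    cs ∈ forests G (Sum.inr X :: s) w ↔
      ∃ t ts u v, cs = t :: ts ∧ w = u ++ v ∧ t ∈ trees G X u ∧ ts ∈ forests G s v := by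
  have hvars : varsOf (Sum.inr X :: s : List (A ⊕ V)) = X :: varsOf s := by simp [varsOf]
  simp only [forests, trees, hvars, Set.mem_ofPred_eq]
  constructor
  · rintro ⟨h, hw⟩
    cases h with
    | @cons _ t _ ts ht hts =>
      exact ⟨t, ts, yield t, yieldAux s (ts.map yield), rfl, by rw [← hw]; rfl, ⟨ht, rfl⟩, hts, rfl⟩
  · rintro ⟨t, ts, u, v, rfl, rfl, ⟨ht, rfl⟩, hts, rfl⟩
    exact ⟨.cons ht hts, rfl⟩

theorem gen_of_mem_forests (s : List (A ⊕ V)) (cs : List (RawTree V A)) {w : List A}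
    (h : cs ∈ forests G s w) : Gen G s w :=
  match s, cs with
  | [], cs => by
    obtain ⟨-, rfl⟩ := mem_forests_nil.1 h
    exact .nil
  | Sum.inl a :: s, cs => by
    obtain ⟨v, rfl, hv⟩ := mem_forests_inl.1 h
    exact .terminal a (gen_of_mem_forests s cs hv)
  | Sum.inr X :: s, [] => by
    obtain ⟨_, _, _, _, h, -⟩ := mem_forests_inr.1 h
    cases h
  | Sum.inr X :: s, .node Y rhs ch :: cs => by
    obtain ⟨_, _, u, v, hcons, rfl, ht, hts⟩ := mem_forests_inr.1 h
    cases hcons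
    obtain ⟨rfl, hP, hch⟩ := node_mem_trees.1 ht
    exact .var hP (gen_of_mem_forests rhs ch hch) (gen_of_mem_forests s cs hts)
termination_by (sizeOf cs, s.length)
decreasing_by all_goals simp_wf; omega

theorem gen_iff_forests_nonempty {s : List (A ⊕ V)} {w : List A} :
    Gen G s w ↔ (forests G s w).Nonempty := by
  refine ⟨fun h => ?_, fun ⟨cs, h⟩ => gen_of_mem_forests s cs h⟩
  induction h with
  | nil => exact ⟨[], mem_forests_nil.2 ⟨rfl, rfl⟩⟩
  | terminal a _ ih =>
    obtain ⟨cs, h⟩ := ih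
    exact ⟨cs, mem_forests_inl.2 ⟨_, rfl, h⟩⟩
  | @var X rhs s u v hP _ _ ihr ihs =>
    obtain ⟨ch, hch⟩ := ihr
    obtain ⟨cs, hcs⟩ := ihs
    exact ⟨.node X rhs ch :: cs, mem_forests_inr.2
      ⟨_, _, u, v, rfl, rfl, node_mem_trees.2 ⟨rfl, hP, hch⟩, hcs⟩⟩

theorem forests_inl (a : A) (s : List (A ⊕ V)) (w : List A) :
    forests G (Sum.inl a :: s) (a :: w) = forests G s w := by
  ext cs
  rw [mem_forests_inl]
  simp

theorem infinite_forests_cons_left {X : V} {s : List (A ⊕ V)} {u v : List A}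
    (hX : (trees G X u).Infinite) (hs : Gen G s v) :
    (forests G (Sum.inr X :: s) (u ++ v)).Infinite := by
  obtain ⟨cs, hcs⟩ := gen_iff_forests_nonempty.1 hs
  refine Set.infinite_of_injOn_mapsTo (f := fun t => t :: cs) (fun _ _ _ _ h => ?_)
    (fun t ht => mem_forests_inr.2 ⟨t, cs, u, v, rfl, rfl, ht, hcs⟩) hX
  exact (List.cons.inj h).1

theorem infinite_forests_cons_right {X : V} {s : List (A ⊕ V)} {u v : List A}
    (hX : (trees G X u).Nonempty) (hs : (forests G s v).Infinite) :
    (forests G (Sum.inr X :: s) (u ++ v)).Infinite := by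
  obtain ⟨t, ht⟩ := hX
  exact Set.infinite_of_injOn_mapsTo (f := fun cs => t :: cs)
    (fun _ _ _ _ h => (List.cons.inj h).2)
    (fun cs hcs => mem_forests_inr.2 ⟨t, cs, u, v, rfl, rfl, ht, hcs⟩) hs

theorem infinite_trees_of_forests {X : V} {rhs : List (A ⊕ V)} {w : List A}
    (hP : (X, rhs) ∈ G.P) (h : (forests G rhs w).Infinite) : (trees G X w).Infinite :=
  Set.infinite_of_injOn_mapsTo (f := RawTree.node X rhs)
    (fun _ _ _ _ h => (RawTree.node.inj h).2.2)
    (fun _ hcs => node_mem_trees.2 ⟨rfl, hP, hcs⟩) h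

theorem exists_infinite_forests (hG : G.P.Finite) {X : V} {w : List A}
    (h : (trees G X w).Infinite) : ∃ rhs, (X, rhs) ∈ G.P ∧ (forests G rhs w).Infinite := by
  by_contra! hfin
  refine h (((hG.inter_of_left {p | p.1 = X}).biUnion
    (t := fun p => RawTree.node X p.2 '' forests G p.2 w) ?_).subset ?_)
  · rintro ⟨Y, rhs⟩ ⟨hP, rfl⟩
    exact (hfin rhs hP).image _
  · rintro ⟨Y, rhs, cs⟩ ht
    obtain ⟨rfl, hP, hcs⟩ := node_mem_trees.1 ht
    exact Set.mem_biUnion (x := (Y, rhs)) ⟨hP, rfl⟩ ⟨cs, hcs, rfl⟩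

theorem exists_infinite_trees {s : List (A ⊕ V)} {w : List A} (h : (forests G s w).Infinite) :
    ∃ α Z β u v x, s = α ++ Sum.inr Z :: β ∧ w = u ++ (v ++ x) ∧ Gen G α u ∧
      (trees G Z v).Infinite ∧ Gen G β x := by
  induction s generalizing w with
  | nil => exact absurd ((Set.finite_singleton []).subset fun _ h => (mem_forests_nil.1 h).1) h
  | cons c s ih =>
    cases c with
    | inl a =>
      obtain ⟨cs, hcs⟩ := h.nonempty
      obtain ⟨w, rfl, -⟩ := mem_forests_inl.1 hcs
      rw [forests_inl] at h
      obtain ⟨α, Z, β, u, v, x, rfl, rfl, hu, hZ, hx⟩ := ih h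
      exact ⟨Sum.inl a :: α, Z, β, a :: u, v, x, rfl, rfl, .terminal a hu, hZ, hx⟩
    | inr X =>
      obtain ⟨n, hn⟩ : ∃ n, (Set.image2 List.cons (trees G X (w.take n))
          (forests G s (w.drop n))).Infinite := by
        by_contra! hfin
        refine h (((Set.finite_Iic w.length).biUnion fun n _ =>
          hfin n).subset fun cs hcs => ?_)
        obtain ⟨t, ts, u, v, rfl, rfl, ht, hts⟩ := mem_forests_inr.1 hcs
        refine Set.mem_biUnion (x := u.length) (by simp) ⟨t, ?_, ts, ?_, rfl⟩
        · simpa using ht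
        · simpa using hts
      obtain ⟨_, t, ht, ts, hts, -⟩ := hn.nonempty
      rw [← List.take_append_drop n w]
      by_cases hX : (trees G X (w.take n)).Infinite
      · exact ⟨[], X, s, [], _, _, rfl, rfl, .nil, hX, gen_iff_forests_nonempty.2 ⟨ts, hts⟩⟩
      · have hs : (forests G s (w.drop n)).Infinite := fun hs =>
          hn ((Set.not_infinite.1 hX).image2 _ hs)
        obtain ⟨α, Z, β, u, v, x, rfl, hw, hu, hZ, hx⟩ := ih hs
        obtain ⟨Y, rhs, ch⟩ := t
        obtain ⟨rfl, hP, hch⟩ := node_mem_trees.1 ht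
        refine ⟨Sum.inr Y :: α, Z, β, w.take n ++ u, v, x, rfl, ?_,
          .var hP (gen_of_mem_forests _ _ hch) hu, hZ, hx⟩
        rw [hw, List.append_assoc]

/-- `X` has a production containing `Y` whose remaining symbols generate the empty word. -/
def UnitStep (G : CFG V A) (X Y : V) : Prop :=
  ∃ α β, (X, α ++ Sum.inr Y :: β) ∈ G.P ∧ Gen G α [] ∧ Gen G β []

/-- `X` derives itself nontrivially in a context that generates the empty word. -/
def Cyclic (G : CFG V A) (X : V) : Prop := Relation.TransGen (UnitStep G) X X

theorem exists_mem_forests_append_cons {α β : List (A ⊕ V)} {Z : V} {t : RawTree V A} {u v x : List A}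
    (hα : Gen G α u) (ht : t ∈ trees G Z v) (hβ : Gen G β x) :
    ∃ cs ∈ forests G (α ++ Sum.inr Z :: β) (u ++ (v ++ x)), t ∈ cs := by
  induction hα with
  | nil =>
    obtain ⟨cs, hcs⟩ := gen_iff_forests_nonempty.1 hβ
    exact ⟨t :: cs, mem_forests_inr.2 ⟨t, cs, v, x, rfl, rfl, ht, hcs⟩, by simp⟩
  | terminal a _ ih =>
    obtain ⟨cs, hcs, h⟩ := ih
    exact ⟨cs, mem_forests_inl.2 ⟨_, rfl, hcs⟩, h⟩
  | @var X rhs s y z hP hr _ _ ih =>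
    obtain ⟨cs, hcs, h⟩ := ih
    obtain ⟨ch, hch⟩ := gen_iff_forests_nonempty.1 hr
    exact ⟨.node X rhs ch :: cs, mem_forests_inr.2 ⟨_, cs, y, _, rfl, by simp,
      node_mem_trees.2 ⟨rfl, hP, hch⟩, hcs⟩, by simp [h]⟩

theorem UnitStep.exists_larger_tree {X Y : V} (h : UnitStep G X Y) {w : List A} {t : RawTree V A}
    (ht : t ∈ trees G Y w) : ∃ t' ∈ trees G X w, sizeOf t < sizeOf t' := by
  obtain ⟨α, β, hP, hα, hβ⟩ := h
  obtain ⟨cs, hcs, hmem⟩ := exists_mem_forests_append_cons hα ht hβ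
  refine ⟨.node X _ cs, node_mem_trees.2 ⟨rfl, hP, by simpa using hcs⟩, ?_⟩
  have := List.sizeOf_lt_of_mem hmem
  simp only [RawTree.node.sizeOf_spec]
  omega

theorem exists_larger_tree_of_transGen {X Y : V} (h : Relation.TransGen (UnitStep G) X Y)
    {w : List A} {t : RawTree V A} (ht : t ∈ trees G Y w) :
    ∃ t' ∈ trees G X w, sizeOf t < sizeOf t' := by
  induction h using Relation.TransGen.head_induction_on with
  | single h => exact h.exists_larger_tree ht
  | head h _ ih =>
    obtain ⟨t₁, ht₁, hlt₁⟩ := ih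
    obtain ⟨t₂, ht₂, hlt₂⟩ := h.exists_larger_tree ht₁
    exact ⟨t₂, ht₂, hlt₁.trans hlt₂⟩

theorem Cyclic.infinite_trees {X : V} (hX : Cyclic G X) {w : List A}
    (h : (trees G X w).Nonempty) : (trees G X w).Infinite := fun hfin => by
  obtain ⟨t, ht, hmax⟩ := Set.exists_max_image _ sizeOf hfin h
  obtain ⟨t', ht', hlt⟩ := exists_larger_tree_of_transGen hX ht
  exact (hmax t' ht').not_gt hlt

/-- Forget the marks on the variables of a sentential form. -/
def unmark (s : List (A ⊕ V × Bool)) : List (A ⊕ V) := s.map (Sum.map id Prod.fst)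

/-- Turn the variables of a sentential form into variables with mark `false`. -/
def withoutMark (s : List (A ⊕ V)) : List (A ⊕ V × Bool) := s.map (Sum.map id (·, false))

theorem unmark_withoutMark (s : List (A ⊕ V)) : unmark (withoutMark s) = s := by
  have : (Sum.map id Prod.fst ∘ Sum.map id (·, false) : A ⊕ V → A ⊕ V) = id := by
    ext x; cases x <;> rfl
  simp [unmark, withoutMark, this]

/-- The grammar in which marks trace a path in a derivation tree towards a cyclic variable. -/
def marked (G : CFG V A) : CFG (V × Bool) A where
  P := {p | (p.1.1, unmark p.2) ∈ G.P ∧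
    (p.1.2 = true → Cyclic G p.1.1 ∨ ∃ Z, Sum.inr (Z, true) ∈ p.2)}

theorem finite_marked [Finite V] [Finite A] (hG : G.P.Finite) : (marked G).P.Finite := by
  have hfin := Set.Finite.preimage' (f := fun p : (V × Bool) × List (A ⊕ V × Bool) =>
    (p.1.1, unmark p.2)) hG fun b _ => by
      refine (Set.finite_univ.prod (List.finite_length_eq (A ⊕ V × Bool) b.2.length)).subset ?_
      rintro p rfl
      simp [unmark]
  exact hfin.subset fun p hp => hp.1

theorem Gen.withoutMark {s : List (A ⊕ V)} {w : List A} (h : Gen G s w) :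
    Gen (marked G) (withoutMark s) w := by
  induction h with
  | nil => exact .nil
  | terminal a _ ih => exact .terminal a ih
  | @var X rhs s u v hP _ _ ihr ihs =>
    refine .var (X := (X, false)) ⟨?_, by simp⟩ ihr ihs
    rwa [unmark_withoutMark]

theorem trees_nonempty_of_gen {X : V} {rhs : List (A ⊕ V)} {w : List A} (hP : (X, rhs) ∈ G.P)
    (h : Gen G rhs w) : (trees G X w).Nonempty := by
  obtain ⟨cs, hcs⟩ := gen_iff_forests_nonempty.1 h
  exact ⟨.node X rhs cs, node_mem_trees.2 ⟨rfl, hP, hcs⟩⟩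

theorem Gen.unmark {s : List (A ⊕ V × Bool)} {w : List A} (h : Gen (marked G) s w) :
    Gen G (unmark s) w ∧
      ((∃ Z, Sum.inr (Z, true) ∈ s) → (forests G (CFG.unmark s) w).Infinite) := by
  induction h with
  | nil => exact ⟨.nil, by simp⟩
  | @terminal a s w _ ih =>
    refine ⟨.terminal a ih.1, fun ⟨Z, hZ⟩ => ?_⟩
    have := ih.2 ⟨Z, by simpa using hZ⟩
    rwa [← forests_inl a] at this
  | @var X rhs s u v hP _ _ ihr ihs =>
    refine ⟨.var hP.1 ihr.1 ihs.1, fun ⟨Z, hZ⟩ => ?_⟩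
    have hne := trees_nonempty_of_gen hP.1 ihr.1
    rcases List.mem_cons.1 hZ with hZ | hZ
    · have hX : X.2 = true := by rw [← Sum.inr.inj hZ]
      refine infinite_forests_cons_left ?_ ihs.1
      rcases hP.2 hX with hcyc | hmark
      · exact hcyc.infinite_trees hne
      · exact infinite_trees_of_forests hP.1 (ihr.2 hmark)
    · exact infinite_forests_cons_right hne (ihs.2 ⟨Z, hZ⟩)

theorem Gen.single {X : V} {rhs : List (A ⊕ V)} {w : List A} (hP : (X, rhs) ∈ G.P)
    (h : Gen G rhs w) : Gen G [Sum.inr X] w := by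
  simpa using Gen.var hP h .nil

theorem Gen.exists_rhs {X : V} {w : List A} (h : Gen G [Sum.inr X] w) :
    ∃ rhs, (X, rhs) ∈ G.P ∧ Gen G rhs w := by
  generalize hs : [Sum.inr X] = s at h
  cases h with
  | nil => cases hs
  | terminal => cases hs
  | var hP hr hs' =>
    cases hs
    cases hs'
    exact ⟨_, hP, by simpa using hr⟩

theorem wellFounded_transGen_unitStep [Finite V] (G : CFG V A) :
    WellFounded fun X Y : V => Relation.TransGen (UnitStep G) Y X ∧ ¬ Cyclic G Y ∧ ¬ Cyclic G X := by
  let r := fun X Y : V => Relation.TransGen (UnitStep G) Y X ∧ ¬ Cyclic G Y ∧ ¬ Cyclic G X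
  have : IsTrans V r := ⟨fun _ _ _ h₁ h₂ => ⟨h₂.1.trans h₁.1, h₂.2.1, h₁.2.2⟩⟩
  have : Std.Irrefl r := ⟨fun _ h => h.2.1 h.1⟩
  exact Finite.wellFounded_of_trans_of_irrefl r

theorem gen_marked_of_infinite_trees [Finite V] (hG : G.P.Finite) {X : V} {w : List A}
    (h : (trees G X w).Infinite) : Gen (marked G) [Sum.inr (X, true)] w := by
  induction hn : w.length using Nat.strong_induction_on generalizing X w with
  | _ n ihn =>
  induction X using (wellFounded_transGen_unitStep G).induction with
  | _ X ihX =>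
  obtain ⟨rhs, hP, hrhs⟩ := exists_infinite_forests hG h
  have of_cyclic {Y : V} (hY : (trees G Y w).Infinite) (hcyc : Cyclic G Y) :
      Gen (marked G) [Sum.inr (Y, true)] w := by
    obtain ⟨rhs, hP, hrhs⟩ := exists_infinite_forests hG hY
    refine .single ⟨?_, fun _ => .inl hcyc⟩
      (gen_iff_forests_nonempty.2 hrhs.nonempty).withoutMark
    rwa [unmark_withoutMark]
  by_cases hX : Cyclic G X
  · exact of_cyclic h hX
  obtain ⟨α, Z, β, u, v, x, rfl, rfl, hα, hZ, hβ⟩ := exists_infinite_trees hrhs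
  have hgen : Gen (marked G) [Sum.inr (Z, true)] v := by
    by_cases hlt : v.length < n
    · exact ihn _ hlt hZ rfl
    · simp only [List.length_append] at hn
      obtain rfl : u = [] := List.length_eq_zero_iff.1 (by omega)
      obtain rfl : x = [] := List.length_eq_zero_iff.1 (by omega)
      simp only [List.nil_append, List.append_nil] at ihX of_cyclic
      by_cases hZc : Cyclic G Z
      · exact of_cyclic hZ hZc
      · exact ihX Z ⟨.single ⟨α, β, hP, hα, hβ⟩, hX, hZc⟩ hZ
  refine .single (rhs := CFG.withoutMark α ++ ([Sum.inr (Z, true)] ++ CFG.withoutMark β))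
    ⟨?_, fun _ => .inr ⟨Z, by simp⟩⟩ (hα.withoutMark.append (hgen.append hβ.withoutMark))
  have hα' := unmark_withoutMark α
  have hβ' := unmark_withoutMark β
  unfold CFG.unmark at *
  simpa [hα', hβ'] using hP

theorem gen_marked_iff [Finite V] (hG : G.P.Finite) {X : V} {w : List A} :
    Gen (marked G) [Sum.inr (X, true)] w ↔ (trees G X w).Infinite := by
  refine ⟨fun h => ?_, gen_marked_of_infinite_trees hG⟩
  obtain ⟨rhs, hP, hr⟩ := h.exists_rhs
  rcases hP.2 rfl with hcyc | hmark
  · exact hcyc.infinite_trees (trees_nonempty_of_gen hP.1 hr.unmark.1)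
  · exact infinite_trees_of_forests hP.1 (hr.unmark.2 hmark)

end CFG

/-- The language of words having infinitely many `(G,X)`-derivation trees is
context-free: it is generated by some (finite) context-free grammar `G'` from some
start variable `X'`. -/
theorem infinite_ambiguity_language_contextfree {V A : Type} [Fintype V] [Fintype A]
    (G : CFG V A) (hGfin : G.P.Finite) (X : V) :
    ∃ (V' : Type) (_ : Fintype V') (G' : CFG V' A) (X' : V'), G'.P.Finite ∧
      ∀ w : List A,
        Derives G' [Sum.inr X'] (w.map Sum.inl) ↔ amb G X w = (⊤ : ℕ∞) := by
  refine ⟨V × Bool, inferInstance, CFG.marked G, (X, true), CFG.finite_marked hGfin, fun w => ?_⟩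
  rw [CFG.derives_iff_gen, CFG.gen_marked_iff hGfin, amb, Set.encard_eq_top_iff]
  rfl
end
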